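/- arXiv:1802.10210 — 6 statements merged into one kernel-verified Lean document; each statement's English description precedes it below -/
import Mathlib

section
/- Let X be a topological space and g : X → ℂ a continuous function with g(x) ≠ 0 for every x ∈ X. Let E := {(x,w) ∈ X × ℂ : w² = g(x)}, topologized as a subspace of X × ℂ, and let π : E → X be the restriction of the first projection. Then π is a covering map, and every fibre π⁻¹(x) has exactly two elements. -/
/-- A continuous complex function that does not vanish at `x₀` has a continuous square
root on a neighbourhood of `x₀`. -/
theorem exists_continuousOn_sq_eq {X : Type*} [TopologicalSpace X] {g : X → ℂ}
    (hg : Continuous g) {x₀ : X} (h₀ : g x₀ ≠ 0) :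
    ∃ U : Set X, IsOpen U ∧ x₀ ∈ U ∧
      ∃ s : X → ℂ, ContinuousOn s U ∧ ∀ x ∈ U, s x ^ 2 = g x := by
  obtain ⟨c, hc⟩ := IsAlgClosed.exists_pow_nat_eq (g x₀) two_pos
  refine ⟨(fun x => g x / g x₀) ⁻¹' Complex.slitPlane,
    Complex.isOpen_slitPlane.preimage (by fun_prop), by simp [h₀],
    fun x => c * (g x / g x₀) ^ ((2 : ℕ) : ℂ)⁻¹, ?_, fun x _ => ?_⟩
  · exact continuousOn_const.mul <| ContinuousOn.cpow_const (by fun_prop) fun x hx => hx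
  · rw [mul_pow, Complex.cpow_nat_inv_pow _ two_ne_zero, hc, mul_div_cancel₀ _ h₀]

/-- A continuous square root of `g` over an open set trivializes the double cover `w² = g x`. -/
theorem isEvenlyCovered_of_sq_eq {X : Type*} [TopologicalSpace X] {g s : X → ℂ}
    {U : Set X} (hU : IsOpen U) (hs : ContinuousOn s U) (hsg : ∀ x ∈ U, s x ^ 2 = g x)
    (hg0 : ∀ x ∈ U, g x ≠ 0) {x₀ : X} (hx₀ : x₀ ∈ U) :
    IsEvenlyCovered (fun e : {p : X × ℂ // p.2 ^ 2 = g p.1} => (e : X × ℂ).1) x₀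
      ({1, -1} : Set ℂ) := by
  have hs0 (x) (hx : x ∈ U) : s x ≠ 0 := fun h => hg0 x hx (by simp [← hsg x hx, h])
  have hsU : Continuous fun x : U => s x := continuousOn_iff_continuous_domRestrict.mp hs
  exact ⟨inferInstance, U, hx₀, hU, hU.preimage (by fun_prop), {
    toFun e := (⟨e.1.1.1, e.2⟩, ⟨e.1.1.2 / s e.1.1.1, by
      rw [Set.mem_insert_iff, Set.mem_singleton_iff, ← sq_eq_one_iff, div_pow, e.1.2, hsg _ e.2,
        div_self (hg0 _ e.2)]⟩)
    invFun p := ⟨⟨(p.1, p.2 * s p.1), by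
      obtain ⟨x, u, rfl | rfl⟩ := p <;> simp [hsg x x.2]⟩, p.1.2⟩
    left_inv e := by
      ext <;> simp [hs0 _ e.2]
    right_inv p := by
      ext <;> simp [hs0 _ p.1.2]
    continuous_toFun := by
      have hproj : Continuous fun e : (fun e : {p : X × ℂ // p.2 ^ 2 = g p.1} =>
          (e : X × ℂ).1) ⁻¹' U => (⟨e.1.1.1, e.2⟩ : U) := .subtype_mk (by fun_prop) _
      exact hproj.prodMk
        (.subtype_mk (.div (by fun_prop) (hsU.comp hproj) fun e => hs0 _ e.2) _)
    continuous_invFun := by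
      have : Continuous fun p : U × ({1, -1} : Set ℂ) => s p.1 := hsU.comp continuous_fst
      exact .subtype_mk
        (.subtype_mk (.prodMk (by fun_prop) (.mul (by fun_prop) this)) _) _ }, fun _ => rfl⟩

/-- For `X` a topological space and `g : X → ℂ` continuous and
nowhere vanishing, the natural projection from
`E = {(x,w) ∈ X × ℂ : w² = g(x)}` (with the subspace topology) to `X` is a
covering map, and every fibre has exactly two elements. -/
theorem square_root_double_cover
    {X : Type*} [TopologicalSpace X] (g : X → ℂ)
    (hg : Continuous g) (hg0 : ∀ x, g x ≠ 0) :
    IsCoveringMap (fun e : {p : X × ℂ // p.2 ^ 2 = g p.1} => (e : X × ℂ).1) ∧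
      ∀ x : X,
        Nat.card {e : {p : X × ℂ // p.2 ^ 2 = g p.1} // (e : X × ℂ).1 = x}
          = 2 := by
  have key (x : X) : IsEvenlyCovered
      (fun e : {p : X × ℂ // p.2 ^ 2 = g p.1} => (e : X × ℂ).1) x ({1, -1} : Set ℂ) :=
    have ⟨_, hU, hx, _, hs, hsg⟩ := exists_continuousOn_sq_eq hg (hg0 x)
    isEvenlyCovered_of_sq_eq hU hs hsg (fun y _ => hg0 y) hx
  refine ⟨fun x => (key x).to_isEvenlyCovered_preimage, fun x => ?_⟩
  exact (Nat.card_congr (key x).fiberHomeomorph.symm.toEquiv).trans <|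
    (Nat.card_coe_set_eq _).trans <| Set.ncard_pair (by norm_num)
end

section
/- Let V be a finite-dimensional vector space over ℚ of dimension n and f : V → V a ℚ-linear endomorphism whose minimal polynomial p is irreducible over ℚ of degree d. Let f_ℂ : ℂ ⊗_ℚ V → ℂ ⊗_ℚ V denote the complexification (base change to ℂ) of f. Then for every complex root λ of p, the λ-eigenspace ker(f_ℂ − λ·id) has ℂ-dimension exactly n/d. -/
section

variable {K L V : Type*} [Field K] [Field L] [Algebra K L] [AddCommGroup V] [Module K V]

/-- The base change of an endomorphism is annihilated by the minimal polynomial. -/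
theorem aeval_baseChange_map_minpoly (f : Module.End K V) :
    Polynomial.aeval (LinearMap.baseChange L f : Module.End L (TensorProduct K L V))
      ((minpoly K f).map (algebraMap K L)) = 0 := by
  rw [Polynomial.aeval_map_algebraMap]
  have h := Polynomial.aeval_algHom_apply (Module.End.baseChangeHom K L V) f (minpoly K f)
  rwa [minpoly.aeval, map_zero] at h

variable [FiniteDimensional K V]

variable (L) in
/-- Roots of the characteristic polynomial in an extension field are roots of the minimal
polynomial. -/
theorem aeval_minpoly_eq_zero_of_aeval_charpoly_eq_zero (f : Module.End K V) {μ : L}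
    (hμ : Polynomial.aeval μ f.charpoly = 0) : Polynomial.aeval μ (minpoly K f) = 0 := by
  have hroot : (LinearMap.baseChange L f).charpoly.IsRoot μ := by
    rwa [LinearMap.charpoly_baseChange, Polynomial.IsRoot, Polynomial.eval_map_algebraMap]
  have hev := Module.End.isRoot_of_hasEigenvalue
    ((Module.End.hasEigenvalue_iff_isRoot_charpoly _ μ).2 hroot)
  simpa [Polynomial.IsRoot, Polynomial.eval_map_algebraMap] using
    hev.dvd (minpoly.dvd L _ (aeval_baseChange_map_minpoly (L := L) f))

/-- If the minimal polynomial of an endomorphism is irreducible, then the characteristic polynomial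
is a power of it. -/
theorem charpoly_eq_minpoly_pow_of_irreducible (f : Module.End K V)
    (hirr : Irreducible (minpoly K f)) : ∃ m : ℕ, f.charpoly = minpoly K f ^ m := by
  have hmonic := minpoly.monic (Algebra.IsIntegral.isIntegral (R := K) f)
  have hfin := FiniteMultiplicity.of_not_isUnit hirr.not_isUnit f.charpoly_monic.ne_zero
  obtain ⟨q, hq, hndvd⟩ := hfin.exists_eq_pow_mul_and_not_dvd
  refine ⟨multiplicity (minpoly K f) f.charpoly, hq.trans ?_⟩
  have hqmonic : q.Monic := (hmonic.pow _).of_mul_monic_left (hq ▸ f.charpoly_monic)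
  by_cases hdeg : q.degree = 0
  · rw [hqmonic.degree_le_zero_iff_eq_one.1 hdeg.le, mul_one]
  obtain ⟨μ, hμ⟩ := IsAlgClosed.exists_aeval_eq_zero (AlgebraicClosure K) q hdeg
  have hroot := aeval_minpoly_eq_zero_of_aeval_charpoly_eq_zero (AlgebraicClosure K) f
    (μ := μ) (by rw [hq, map_mul, hμ, mul_zero])
  exact absurd (minpoly.eq_of_irreducible_of_monic hirr hroot hmonic ▸ minpoly.dvd K μ hμ) hndvd

/-- For an endomorphism with irreducible separable minimal polynomial, the eigenspace of the base
change at a root of the minimal polynomial has dimension the quotient of the dimension of the space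
by the degree of the minimal polynomial. -/
theorem finrank_eigenspace_baseChange_of_irreducible_minpoly (f : Module.End K V)
    (hirr : Irreducible (minpoly K f)) (hsep : (minpoly K f).Separable) {μ : L}
    (hμ : Polynomial.aeval μ (minpoly K f) = 0) :
    Module.finrank L (Module.End.eigenspace
      (LinearMap.baseChange L f : Module.End L (TensorProduct K L V)) μ) =
      Module.finrank K V / (minpoly K f).natDegree := by
  classical
  obtain ⟨m, hm⟩ := charpoly_eq_minpoly_pow_of_irreducible f hirr
  have hsepL : ((minpoly K f).map (algebraMap K L)).Separable := hsep.map
  have hss := Module.End.isSemisimple_of_squarefree_aeval_eq_zero hsepL.squarefree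
    (aeval_baseChange_map_minpoly f)
  have hroot : ((minpoly K f).map (algebraMap K L)).rootMultiplicity μ = 1 := by
    refine le_antisymm (Polynomial.rootMultiplicity_le_one_of_separable hsepL μ) ?_
    exact (Polynomial.rootMultiplicity_pos hsepL.ne_zero).2
      (by rwa [Polynomial.IsRoot, Polynomial.eval_map_algebraMap])
  rw [← hss.isFinitelySemisimple.maxGenEigenspace_eq_eigenspace,
    LinearMap.finrank_maxGenEigenspace_eq, LinearMap.charpoly_baseChange, hm,
    Polynomial.map_pow, ← Polynomial.count_roots, Polynomial.roots_pow, Multiset.count_nsmul,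
    Polynomial.count_roots, hroot, mul_one, ← f.charpoly_natDegree, hm, Polynomial.natDegree_pow,
    Nat.mul_div_cancel _ hirr.natDegree_pos]

end


/-- Let `f` be an endomorphism of an `n`-dimensional `ℚ`-vector
space whose minimal polynomial `p` is irreducible of degree `d`, and let
`f_ℂ = id_ℂ ⊗ f` be its complexification on `ℂ ⊗_ℚ V`.  Then for every
complex root `λ` of `p`, the eigenspace `ker (f_ℂ − λ·id)` has `ℂ`-dimension
exactly `n / d`. -/
theorem eigenspace_dim_of_complexification
    (V : Type*) [AddCommGroup V] [Module ℚ V] [FiniteDimensional ℚ V]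
    (n : ℕ) (hn : Module.finrank ℚ V = n)
    (f : V →ₗ[ℚ] V) (d : ℕ)
    (hirr : Irreducible (minpoly ℚ f))
    (hd : (minpoly ℚ f).natDegree = d)
    (lam : ℂ) (hlam : Polynomial.aeval lam (minpoly ℚ f) = 0) :
    Module.finrank ℂ
        (Module.End.eigenspace
          (LinearMap.baseChange ℂ f :
            Module.End ℂ (TensorProduct ℚ ℂ V)) lam)
      = n / d := by
  subst hn hd
  exact finrank_eigenspace_baseChange_of_irreducible_minpoly f hirr hirr.separable hlam
end

section
/- The polynomial q(X) = X⁴ − 26·X² + 52 is irreducible over ℚ. Moreover, if K denotes the splitting field of q over ℚ, then [K : ℚ] = 4, the extension K/ℚ is Galois, and its Galois group Gal(K/ℚ) is cyclic of order 4. (Equivalently: ℚ(√(13 − 3√13)) is a cyclic quartic number field.) -/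
open Polynomial

theorem monic_X_pow_four_sub_add {R : Type*} [CommRing R] :
    (X ^ 4 - 26 * X ^ 2 + 52 : R[X]).Monic := by
  have h : (X ^ 4 - 26 * X ^ 2 + 52 : R[X]) = X ^ 4 - C 26 * X ^ 2 + C 52 := by
    simp only [map_ofNat]
  rw [h]
  monicity!

theorem natDegree_X_pow_four_sub_add {R : Type*} [CommRing R] [Nontrivial R] :
    (X ^ 4 - 26 * X ^ 2 + 52 : R[X]).natDegree = 4 := by
  have h : (X ^ 4 - 26 * X ^ 2 + 52 : R[X]) = X ^ 4 - C 26 * X ^ 2 + C 52 := by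
    simp only [map_ofNat]
  rw [h]
  compute_degree!

/-- Eisenstein's criterion at `13`. -/
theorem irreducible_X_pow_four_sub_add_int : Irreducible (X ^ 4 - 26 * X ^ 2 + 52 : ℤ[X]) := by
  have hcoeff (n : ℕ) : (X ^ 4 - 26 * X ^ 2 + 52 : ℤ[X]).coeff n =
      (if n = 4 then 1 else 0) - 26 * (if n = 2 then 1 else 0) + if n = 0 then 52 else 0 := by
    have h : (X ^ 4 - 26 * X ^ 2 + 52 : ℤ[X]) = X ^ 4 - C 26 * X ^ 2 + C 52 := by
      simp only [map_ofNat]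
    rw [h, coeff_add, coeff_sub, coeff_C_mul, coeff_X_pow, coeff_X_pow, coeff_C]
  have hprime : (Ideal.span {(13 : ℤ)}).IsPrime := by
    rw [Ideal.span_singleton_prime (by norm_num)]
    norm_num
  refine irreducible_of_eisenstein_criterion hprime ?_ ?_ ?_ ?_
    monic_X_pow_four_sub_add.isPrimitive
  · rw [monic_X_pow_four_sub_add.leadingCoeff, Ideal.mem_span_singleton]
    norm_num
  · intro n hn
    rw [degree_eq_natDegree monic_X_pow_four_sub_add.ne_zero, natDegree_X_pow_four_sub_add,
      Nat.cast_lt] at hn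
    rw [Ideal.mem_span_singleton, hcoeff]
    interval_cases n <;> norm_num
  · rw [degree_eq_natDegree monic_X_pow_four_sub_add.ne_zero, natDegree_X_pow_four_sub_add]
    norm_num
  · rw [hcoeff, Ideal.span_singleton_pow, Ideal.mem_span_singleton]
    norm_num

theorem irreducible_X_pow_four_sub_add_rat : Irreducible (X ^ 4 - 26 * X ^ 2 + 52 : ℚ[X]) := by
  have h := (monic_X_pow_four_sub_add.irreducible_iff_irreducible_map_fraction_map (K := ℚ)).1
    irreducible_X_pow_four_sub_add_int
  simpa using h

theorem root_conj_sq {K : Type*} [Field K] [CharZero K] {a : K}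
    (ha : a ^ 4 - 26 * a ^ 2 + 52 = 0) : ((a ^ 3 - 22 * a) / 6) ^ 2 = 26 - a ^ 2 := by
  linear_combination (a ^ 2 - 18) / 36 * ha

/-- The roots of `X ^ 4 - 26 * X ^ 2 + 52` are `± a` and `± (a ^ 3 - 22 * a) / 6`, for any
root `a`. -/
theorem eq_or_eq_of_root {K : Type*} [Field K] [CharZero K] {a x : K}
    (ha : a ^ 4 - 26 * a ^ 2 + 52 = 0) (hx : x ^ 4 - 26 * x ^ 2 + 52 = 0) :
    x = a ∨ x = -a ∨ x = (a ^ 3 - 22 * a) / 6 ∨ x = -((a ^ 3 - 22 * a) / 6) := by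
  have h : (x ^ 2 - a ^ 2) * (x ^ 2 - ((a ^ 3 - 22 * a) / 6) ^ 2) = 0 := by
    rw [root_conj_sq ha]
    linear_combination hx - ha
  rcases mul_eq_zero.1 h with h | h <;>
    rcases sq_eq_sq_iff_eq_or_eq_neg.1 (sub_eq_zero.1 h) with h | h <;> simp [h]

section SplittingField

variable {K : Type*} [Field K] [Algebra ℚ K]

theorem aeval_X_pow_four_sub_add (x : K) :
    aeval x (X ^ 4 - 26 * X ^ 2 + 52 : ℚ[X]) = x ^ 4 - 26 * x ^ 2 + 52 := by
  simp only [map_add, map_sub, map_mul, map_pow, aeval_X, map_ofNat]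

theorem minpoly_eq_of_root {x : K} (hx : x ^ 4 - 26 * x ^ 2 + 52 = 0) :
    minpoly ℚ x = X ^ 4 - 26 * X ^ 2 + 52 :=
  (minpoly.eq_of_irreducible_of_monic irreducible_X_pow_four_sub_add_rat
    (by rw [aeval_X_pow_four_sub_add, hx]) monic_X_pow_four_sub_add).symm

variable [IsSplittingField ℚ K (X ^ 4 - 26 * X ^ 2 + 52 : ℚ[X])]

variable (K) in
theorem exists_root_of_isSplittingField : ∃ a : K, a ^ 4 - 26 * a ^ 2 + 52 = 0 := by
  obtain ⟨a, ha⟩ := (IsSplittingField.splits K (X ^ 4 - 26 * X ^ 2 + 52 : ℚ[X])).exists_eval_eq_zero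
    (by rw [degree_map]; exact irreducible_X_pow_four_sub_add_rat.degree_pos.ne')
  rw [eval_map_algebraMap, aeval_X_pow_four_sub_add] at ha
  exact ⟨a, ha⟩

theorem adjoin_root_eq_top {a : K} (ha : a ^ 4 - 26 * a ^ 2 + 52 = 0) :
    IntermediateField.adjoin ℚ {a} = ⊤ := by
  have : CharZero K := algebraRat.charZero K
  rw [← IntermediateField.toSubalgebra_inj, IntermediateField.top_toSubalgebra, eq_top_iff,
    ← IsSplittingField.adjoin_rootSet K (X ^ 4 - 26 * X ^ 2 + 52 : ℚ[X]), Algebra.adjoin_le_iff]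
  intro x hx
  have hx' := (mem_rootSet.1 hx).2
  rw [aeval_X_pow_four_sub_add] at hx'
  have hmem : a ∈ IntermediateField.adjoin ℚ {a} :=
    IntermediateField.mem_adjoin_simple_self ℚ a
  have hb : (a ^ 3 - 22 * a) / 6 ∈ IntermediateField.adjoin ℚ {a} :=
    div_mem (sub_mem (pow_mem hmem 3) (mul_mem (ofNat_mem _ 22) hmem)) (ofNat_mem _ 6)
  rcases eq_or_eq_of_root ha hx' with rfl | rfl | rfl | rfl
  exacts [hmem, neg_mem hmem, hb, neg_mem hb]

variable (K) in
theorem finrank_eq_four_of_isSplittingField : Module.finrank ℚ K = 4 := by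
  obtain ⟨a, ha⟩ := exists_root_of_isSplittingField K
  have hint : IsIntegral ℚ a :=
    ⟨_, monic_X_pow_four_sub_add, (aeval_X_pow_four_sub_add a).trans ha⟩
  rw [← IntermediateField.finrank_top', ← adjoin_root_eq_top ha,
    IntermediateField.adjoin.finrank hint, minpoly_eq_of_root ha, natDegree_X_pow_four_sub_add]

variable (K) in
theorem isGalois_of_isSplittingField : IsGalois ℚ K :=
  IsGalois.of_separable_splitting_field irreducible_X_pow_four_sub_add_rat.separable

variable (K) in
theorem card_algEquiv_eq_four_of_isSplittingField : Nat.card (K ≃ₐ[ℚ] K) = 4 := by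
  have := isGalois_of_isSplittingField K
  have := IsSplittingField.finiteDimensional K (X ^ 4 - 26 * X ^ 2 + 52 : ℚ[X])
  rw [IsGalois.card_aut_eq_finrank, finrank_eq_four_of_isSplittingField K]

variable (K) in
/-- The automorphism sending a root `a` to `(a ^ 3 - 22 * a) / 6` squares to one sending `a`
to `-a`, so it has order `4`. -/
theorem isCyclic_algEquiv_of_isSplittingField : IsCyclic (K ≃ₐ[ℚ] K) := by
  have : CharZero K := algebraRat.charZero K
  have := isGalois_of_isSplittingField K
  have := IsSplittingField.finiteDimensional K (X ^ 4 - 26 * X ^ 2 + 52 : ℚ[X])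
  have hcard := card_algEquiv_eq_four_of_isSplittingField K
  obtain ⟨a, ha⟩ := exists_root_of_isSplittingField K
  have hsq := root_conj_sq ha
  obtain ⟨σ, hσ⟩ : ∃ σ : K ≃ₐ[ℚ] K, σ a = (a ^ 3 - 22 * a) / 6 := by
    have hb : ((a ^ 3 - 22 * a) / 6) ^ 4 - 26 * ((a ^ 3 - 22 * a) / 6) ^ 2 + 52 = 0 := by
      linear_combination (((a ^ 3 - 22 * a) / 6) ^ 2 - a ^ 2) * hsq + ha
    have h : IsConjRoot ℚ ((a ^ 3 - 22 * a) / 6) a := by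
      rw [IsConjRoot, minpoly_eq_of_root ha, minpoly_eq_of_root hb]
    exact isConjRoot_iff_exists_algEquiv.1 h
  have hσσ : σ (σ a) = -a := by
    rw [hσ, map_div₀, map_sub, map_mul, map_pow, hσ, map_ofNat, map_ofNat]
    linear_combination (a ^ 3 - 22 * a) / 36 * hsq - a / 36 * ha
  have hne : ¬σ ^ 2 ^ 1 = 1 := by
    intro h
    have hfix : σ (σ a) = a := by simpa [pow_two] using DFunLike.congr_fun h a
    have h0 : a = 0 := self_eq_neg.1 (hfix.symm.trans hσσ)
    simp [h0] at ha
  refine isCyclic_of_orderOf_eq_card σ ?_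
  rw [hcard]
  exact orderOf_eq_prime_pow hne (by rw [← pow_card_eq_one' (x := σ), hcard]; rfl)

end SplittingField

/-- The polynomial `q = X⁴ − 26X² + 52` is irreducible over `ℚ`;
its splitting field `K` satisfies `[K : ℚ] = 4`, is Galois over `ℚ`, and has
cyclic Galois group of order `4`. -/
theorem quartic_cyclic_field :
    Irreducible (X ^ 4 - 26 * X ^ 2 + 52 : ℚ[X]) ∧
    Module.finrank ℚ (X ^ 4 - 26 * X ^ 2 + 52 : ℚ[X]).SplittingField = 4 ∧
    IsGalois ℚ (X ^ 4 - 26 * X ^ 2 + 52 : ℚ[X]).SplittingField ∧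
    IsCyclic (X ^ 4 - 26 * X ^ 2 + 52 : ℚ[X]).Gal ∧
    Nat.card (X ^ 4 - 26 * X ^ 2 + 52 : ℚ[X]).Gal = 4 := by
  have : IsSplittingField ℚ (X ^ 4 - 26 * X ^ 2 + 52 : ℚ[X]).SplittingField
      (X ^ 4 - 26 * X ^ 2 + 52 : ℚ[X]) := by
    convert IsSplittingField.splittingField (X ^ 4 - 26 * X ^ 2 + 52 : ℚ[X])
    exact Subsingleton.elim _ _
  exact ⟨irreducible_X_pow_four_sub_add_rat, finrank_eq_four_of_isSplittingField _,
    isGalois_of_isSplittingField _, isCyclic_algEquiv_of_isSplittingField _,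
    card_algEquiv_eq_four_of_isSplittingField _⟩
end

section
/- Let q(X) = X⁴ − 26·X² + 52, an irreducible polynomial over ℚ, and let K = ℚ[X]/(q(X)), a number field of degree 4 over ℚ. Then there exist elements a, b ∈ K such that, in the polynomial ring ℂ[x,y,z], one has the identity x⁴ − 2x³y − 5x²y² − 26x²z² + 6xy³ + 104xyz² + 9y⁴ − 130y²z² + 52z⁴ = Π_σ (x + σ(a)·y + σ(b)·z), where the product runs over all four ℚ-algebra homomorphisms σ : K → ℂ. In other words, the quartic form f₄(x,y,z) = x⁴ − 2x³y − 5x²y² − 26x²z² + 6xy³ + 104xyz² + 9y⁴ − 130y²z² + 52z⁴ is the norm form N_{K/ℚ}(x + a·y + b·z) of a linear form over K. -/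
open Polynomial

/-- The quartic polynomial `q = X⁴ − 26X² + 52 ∈ ℚ[X]`. -/
noncomputable def q13 : ℚ[X] := X ^ 4 - 26 * X ^ 2 + 52

theorem quartic_form_factorization {R : Type*} [CommRing R] {α t u : R}
    (hα : α ^ 2 + α = 3) (ht : t ^ 2 = 16 + 6 * α) (hu : u ^ 2 = 10 - 6 * α) (x y z : R) :
    x ^ 4 - 2 * x ^ 3 * y - 5 * x ^ 2 * y ^ 2 - 26 * x ^ 2 * z ^ 2 + 6 * x * y ^ 3
        + 104 * x * y * z ^ 2 + 9 * y ^ 4 - 130 * y ^ 2 * z ^ 2 + 52 * z ^ 4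
      = (x + α * y + t * z) * ((x + α * y + -t * z) * ((x + (-1 - α) * y + u * z)
          * (x + (-1 - α) * y + -u * z))) := by
  linear_combination (2 * (x ^ 2 - x * y - 3 * y ^ 2) * y ^ 2 - (α ^ 2 + α - 3) * y ^ 4
      - 24 * x * y * z ^ 2 + 38 * y ^ 2 * z ^ 2 + 36 * z ^ 4) * hα
    + z ^ 2 * ((x + (-1 - α) * y) ^ 2 - u ^ 2 * z ^ 2) * ht
    + z ^ 2 * ((x + α * y) ^ 2 - (16 + 6 * α) * z ^ 2) * hu

theorem q13_aroots {α t u : ℂ} (hα : α ^ 2 + α = 3) (ht : t ^ 2 = 16 + 6 * α)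
    (hu : u ^ 2 = 10 - 6 * α) : q13.aroots ℂ = {t, -t, u, -u} := by
  have hmap : q13.map (algebraMap ℚ ℂ)
      = (({t, -t, u, -u} : Multiset ℂ).map fun r => X - C r).prod := by
    have hαC : (C α : ℂ[X]) ^ 2 + C α = 3 := by rw [← C_pow, ← C_add, hα]; rfl
    have htC : (C t : ℂ[X]) ^ 2 = 16 + 6 * C α := by rw [← C_pow, ht]; simp only [C_add, C_mul]; rfl
    have huC : (C u : ℂ[X]) ^ 2 = 10 - 6 * C α := by rw [← C_pow, hu]; simp only [C_sub, C_mul]; rfl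
    simp only [q13, Polynomial.map_add, Polynomial.map_sub, Polynomial.map_mul,
      Polynomial.map_pow, map_X, Polynomial.map_ofNat, Multiset.insert_eq_cons,
      Multiset.map_cons, Multiset.map_singleton, Multiset.prod_cons, Multiset.prod_singleton,
      C_neg]
    linear_combination 36 * hαC + (X ^ 2 - C u ^ 2) * htC + (X ^ 2 - 16 - 6 * C α) * huC
  rw [aroots_def, hmap, roots_multiset_prod_X_sub_C]

theorem AdjoinRoot.prod_algHom_eq_prod_aroots {F E M : Type*} [Field F] [Field E] [Algebra F E]
    [CommMonoid M] {f : F[X]} (hf : f ≠ 0) (hsep : f.Separable)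
    [Fintype (AdjoinRoot f →ₐ[F] E)] (g : E → M) :
    ∏ σ : AdjoinRoot f →ₐ[F] E, g (σ (AdjoinRoot.root f)) = ((f.aroots E).map g).prod := by
  classical
  have hnodup : (f.aroots E).Nodup := nodup_roots hsep.map
  trans ∏ r : {x // x ∈ f.aroots E}, g r
  · refine Fintype.prod_equiv (AdjoinRoot.equiv E F f hf) _ _ fun σ => ?_
    rfl
  · rw [← Finset.prod_subtype (f.aroots E).toFinset (by simp) g, Finset.prod_eq_multiset_prod,
      Multiset.toFinset_val, hnodup.dedup]

/-- Let `q = X⁴ − 26X² + 52` (irreducible over `ℚ`) and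
`K = ℚ[X]/(q)`, a quartic number field.  Then there are `a, b ∈ K` such that
in `ℂ[x,y,z]` the quartic form
`f₄ = x⁴ − 2x³y − 5x²y² − 26x²z² + 6xy³ + 104xyz² + 9y⁴ − 130y²z² + 52z⁴`
equals the product `∏_σ (x + σ(a)·y + σ(b)·z)` over the four `ℚ`-algebra
homomorphisms `σ : K → ℂ`; i.e. `f₄` is the norm form of a linear form
over `K`. -/
theorem quartic_form_is_norm_form (hq : Irreducible q13) :
    haveI : FiniteDimensional ℚ (AdjoinRoot q13) :=
      PowerBasis.finite (AdjoinRoot.powerBasis hq.ne_zero)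
    haveI : Fact (Irreducible q13) := ⟨hq⟩
    ∃ a b : AdjoinRoot q13,
      (MvPolynomial.X 0 ^ 4
        - 2 * MvPolynomial.X 0 ^ 3 * MvPolynomial.X 1
        - 5 * MvPolynomial.X 0 ^ 2 * MvPolynomial.X 1 ^ 2
        - 26 * MvPolynomial.X 0 ^ 2 * MvPolynomial.X 2 ^ 2
        + 6 * MvPolynomial.X 0 * MvPolynomial.X 1 ^ 3
        + 104 * MvPolynomial.X 0 * MvPolynomial.X 1 * MvPolynomial.X 2 ^ 2
        + 9 * MvPolynomial.X 1 ^ 4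
        - 130 * MvPolynomial.X 1 ^ 2 * MvPolynomial.X 2 ^ 2
        + 52 * MvPolynomial.X 2 ^ 4 : MvPolynomial (Fin 3) ℂ)
      = ∏ σ : AdjoinRoot q13 →ₐ[ℚ] ℂ,
          (MvPolynomial.X 0 + MvPolynomial.C (σ a) * MvPolynomial.X 1
            + MvPolynomial.C (σ b) * MvPolynomial.X 2) := by
  obtain ⟨s, hs⟩ := IsAlgClosed.exists_pow_nat_eq (13 : ℂ) two_pos
  obtain ⟨α, hα⟩ : ∃ α : ℂ, α ^ 2 + α = 3 := ⟨(s - 1) / 2, by linear_combination hs / 4⟩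
  obtain ⟨t, ht⟩ := IsAlgClosed.exists_pow_nat_eq (16 + 6 * α) two_pos
  obtain ⟨u, hu⟩ := IsAlgClosed.exists_pow_nat_eq (10 - 6 * α) two_pos
  have : FiniteDimensional ℚ (AdjoinRoot q13) :=
    PowerBasis.finite (AdjoinRoot.powerBasis hq.ne_zero)
  have : Fact (Irreducible q13) := ⟨hq⟩
  refine ⟨(AdjoinRoot.root q13 ^ 2 - 16) / 6, AdjoinRoot.root q13, ?_⟩
  have hta : (t ^ 2 - 16) / 6 = α := by linear_combination ht / 6
  have hua : (u ^ 2 - 16) / 6 = -1 - α := by linear_combination hu / 6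
  simp only [map_div₀, map_sub, map_pow, map_ofNat]
  refine Eq.trans ?_ (AdjoinRoot.prod_algHom_eq_prod_aroots hq.ne_zero hq.separable
    (fun r : ℂ => (MvPolynomial.X 0 + MvPolynomial.C ((r ^ 2 - 16) / 6) * MvPolynomial.X 1
      + MvPolynomial.C r * MvPolynomial.X 2 : MvPolynomial (Fin 3) ℂ))).symm
  rw [q13_aroots hα ht hu]
  simp only [Multiset.insert_eq_cons, Multiset.map_cons, Multiset.map_singleton,
    Multiset.prod_cons, Multiset.prod_singleton, neg_sq, hta, hua, map_neg, map_sub, map_one]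
  apply quartic_form_factorization
  · rw [← map_pow, ← map_add, hα, map_ofNat]
  · rw [← map_pow, ht]; simp only [map_add, map_mul, map_ofNat]
  · rw [← map_pow, hu]; simp only [map_sub, map_mul, map_ofNat]
end

section
/- In the polynomial ring ℂ[a,b,c,d], consider the ideal I generated by the four polynomials g₁ = 630272·a − 11421·b·d⁵ + 411400·b·d³ − 871552·b·d − 272976·c²·d² + 315136·c² + 98982·c·d⁴ − 3508064·c·d² + 2205952·c + 233496·d⁴ − 6409856·d² + 4411904, g₂ = 78784·b·c − 243·b·d⁴ + 37040·b·d² + 110528·b − 5808·c²·d + 2106·c·d³ − 319792·c·d + 4968·d³ − 714688·d, g₃ = 243·b·d⁶ − 8960·b·d⁴ + 29952·b·d² − 26624·b + 5808·c²·d³ − 11648·c²·d − 2106·c·d⁵ + 76432·c·d³ − 144768·c·d − 4968·d⁵ + 140608·d³ − 259584·d, and g₄ = 2·c³ + 28·c² − 3·c·d² + 98·c − 8·d² + 104. Then I is a prime ideal and the quotient ring ℂ[a,b,c,d]/I has Krull dimension 1. (Thus the common zero locus C ⊆ 𝔸⁴_ℂ of g₁, g₂, g₃, g₄ is an irreducible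 affine curve.) -/
open MvPolynomial

/-- `g₁` in `ℂ[a,b,c,d]`, with `a = X 0`, `b = X 1`, `c = X 2`, `d = X 3`. -/
noncomputable def curveG₁ : MvPolynomial (Fin 4) ℂ :=
  630272 * X 0 - 11421 * X 1 * X 3 ^ 5 + 411400 * X 1 * X 3 ^ 3
    - 871552 * X 1 * X 3 - 272976 * X 2 ^ 2 * X 3 ^ 2 + 315136 * X 2 ^ 2
    + 98982 * X 2 * X 3 ^ 4 - 3508064 * X 2 * X 3 ^ 2 + 2205952 * X 2
    + 233496 * X 3 ^ 4 - 6409856 * X 3 ^ 2 + 4411904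

/-- `g₂` in `ℂ[a,b,c,d]`. -/
noncomputable def curveG₂ : MvPolynomial (Fin 4) ℂ :=
  78784 * X 1 * X 2 - 243 * X 1 * X 3 ^ 4 + 37040 * X 1 * X 3 ^ 2
    + 110528 * X 1 - 5808 * X 2 ^ 2 * X 3 + 2106 * X 2 * X 3 ^ 3
    - 319792 * X 2 * X 3 + 4968 * X 3 ^ 3 - 714688 * X 3

/-- `g₃` in `ℂ[a,b,c,d]`. -/
noncomputable def curveG₃ : MvPolynomial (Fin 4) ℂ :=
  243 * X 1 * X 3 ^ 6 - 8960 * X 1 * X 3 ^ 4 + 29952 * X 1 * X 3 ^ 2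
    - 26624 * X 1 + 5808 * X 2 ^ 2 * X 3 ^ 3 - 11648 * X 2 ^ 2 * X 3
    - 2106 * X 2 * X 3 ^ 5 + 76432 * X 2 * X 3 ^ 3 - 144768 * X 2 * X 3
    - 4968 * X 3 ^ 5 + 140608 * X 3 ^ 3 - 259584 * X 3

/-- `g₄` in `ℂ[a,b,c,d]`. -/
noncomputable def curveG₄ : MvPolynomial (Fin 4) ℂ :=
  2 * X 2 ^ 3 + 28 * X 2 ^ 2 - 3 * X 2 * X 3 ^ 2 + 98 * X 2
    - 8 * X 3 ^ 2 + 104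

namespace Polynomial

/-- The polynomial `-g₄`, as a polynomial in `d` over `ℂ[c]`. -/
noncomputable def planeCurve : ℂ[X][X] :=
  C (3 * X + 8) * X ^ 2 -
    C (2 * (X ^ 3 + 14 * X ^ 2 + 49 * X + 52))

theorem natDegree_planeCurve : planeCurve.natDegree = 2 := by
  have h : (3 * X + 8 : ℂ[X]) ≠ 0 := fun h => by
    have := congrArg (eval 0) h
    norm_num at this
  unfold planeCurve
  compute_degree!

theorem planeCurve_isPrimitive : planeCurve.IsPrimitive := by
  intro r hr
  rw [C_dvd_iff_dvd_coeff] at hr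
  have h0 := hr 0
  have h2 := hr 2
  simp only [planeCurve, coeff_sub, coeff_C_mul, coeff_X_pow, coeff_C] at h0 h2
  norm_num at h0 h2
  have key : r ∣ (C (104 / 27) : ℂ[X]) := by
    have e : (C (104 / 27) : ℂ[X]) =
        2 * (X ^ 3 + 14 * X ^ 2 + 49 * X + 52) -
          (3 * X + 8) * (C (2 / 3) * X ^ 2 + C (68 / 9) * X + C (338 / 27)) := by
      refine Polynomial.funext fun x => ?_
      simp
      ring
    rw [e]
    exact dvd_sub h0 (Dvd.dvd.mul_right h2 _)
  exact isUnit_of_dvd_unit key (isUnit_C.2 (by norm_num))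

theorem irreducible_planeCurve : Irreducible planeCurve := by
  obtain ⟨r, hr⟩ := IsAlgClosed.exists_root (X ^ 3 + 14 * X ^ 2 + 49 * X + 52 : ℂ[X])
    (by
      have : (X ^ 3 + 14 * X ^ 2 + 49 * X + 52 : ℂ[X]).degree = 3 := by compute_degree!
      rw [this]; norm_num)
  have hr' : r ^ 3 + 14 * r ^ 2 + 49 * r + 52 = 0 := by simpa using hr
  refine irreducible_of_eisenstein_criterion (P := Ideal.span {X - C r})
    ((Ideal.span_singleton_prime (X_sub_C_ne_zero r)).2 (prime_X_sub_C r)) ?_ ?_ ?_ ?_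
    planeCurve_isPrimitive
  · rw [leadingCoeff, natDegree_planeCurve, Ideal.mem_span_singleton, dvd_iff_isRoot]
    simp only [planeCurve, coeff_sub, coeff_C_mul, coeff_X_pow, coeff_C]
    norm_num
    intro h
    have : (52 / 27 : ℂ) = 0 := by
      linear_combination hr' - (r ^ 2 / 3 + 34 / 9 * r + 169 / 27) * h
    norm_num at this
  · intro n hn
    have hn : n < 2 := natDegree_planeCurve ▸ coe_lt_degree.1 hn
    rw [Ideal.mem_span_singleton, dvd_iff_isRoot]
    simp only [planeCurve, coeff_sub, coeff_C_mul, coeff_X_pow, coeff_C]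
    interval_cases n <;> simp [hr']
  · rw [← natDegree_pos_iff_degree_pos, natDegree_planeCurve]; norm_num
  · rw [Ideal.span_singleton_pow, Ideal.mem_span_singleton]
    rintro ⟨q, hq⟩
    simp only [planeCurve, coeff_sub, coeff_C_mul, coeff_X_pow, coeff_C] at hq
    norm_num at hq
    have hd := congrArg (fun p => eval r (derivative p)) hq
    simp [derivative_pow] at hd
    have h2 : (3 * r + 7) * (r + 7) = 0 := by linear_combination hd
    rcases mul_eq_zero.1 h2 with h | h
    · have : (52 - 7 / 3 * (196 / 9) : ℂ) = 0 := by
        obtain rfl : r = -7 / 3 := by linear_combination h / 3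
        linear_combination hr'
      norm_num at this
    · obtain rfl : r = -7 := by linear_combination h
      norm_num at hr'

theorem eval₂_planeCurve {T : Type*} [CommRing T] (f : ℂ[X] →+* T) (x : T) :
    planeCurve.eval₂ f x =
      (3 * f X + 8) * x ^ 2 - 2 * (f X ^ 3 + 14 * f X ^ 2 + 49 * f X + 52) := by
  rw [planeCurve, eval₂_sub, eval₂_mul, eval₂_C, eval₂_C, eval₂_X_pow]
  simp only [map_add, map_mul, map_pow, map_ofNat]

end Polynomial

section CurvePoint

variable {T : Type*} [CommRing T]

/-- The equations `g₁ = g₂ = g₃ = g₄ = 0` for a point `(a, b, c, d)` with coordinates in `T`. -/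
structure IsCurvePoint (a b c d : T) : Prop where
  eq₁ : 630272 * a - 11421 * b * d ^ 5 + 411400 * b * d ^ 3
    - 871552 * b * d - 272976 * c ^ 2 * d ^ 2 + 315136 * c ^ 2
    + 98982 * c * d ^ 4 - 3508064 * c * d ^ 2 + 2205952 * c
    + 233496 * d ^ 4 - 6409856 * d ^ 2 + 4411904 = 0
  eq₂ : 78784 * b * c - 243 * b * d ^ 4 + 37040 * b * d ^ 2
    + 110528 * b - 5808 * c ^ 2 * d + 2106 * c * d ^ 3
    - 319792 * c * d + 4968 * d ^ 3 - 714688 * d = 0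
  eq₃ : 243 * b * d ^ 6 - 8960 * b * d ^ 4 + 29952 * b * d ^ 2
    - 26624 * b + 5808 * c ^ 2 * d ^ 3 - 11648 * c ^ 2 * d
    - 2106 * c * d ^ 5 + 76432 * c * d ^ 3 - 144768 * c * d
    - 4968 * d ^ 5 + 140608 * d ^ 3 - 259584 * d = 0
  eq₄ : 2 * c ^ 3 + 28 * c ^ 2 - 3 * c * d ^ 2 + 98 * c
    - 8 * d ^ 2 + 104 = 0

/-- The sum of the terms of `g₁` not involving `a`. -/
def restG₁ (b c d : T) : T :=
  -11421 * b * d ^ 5 + 411400 * b * d ^ 3 - 871552 * b * d - 272976 * c ^ 2 * d ^ 2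
    + 315136 * c ^ 2 + 98982 * c * d ^ 4 - 3508064 * c * d ^ 2 + 2205952 * c
    + 233496 * d ^ 4 - 6409856 * d ^ 2 + 4411904

/-- The coefficient of `b` in `g₂`. -/
def leadG₂ (c d : T) : T := 78784 * c - 243 * d ^ 4 + 37040 * d ^ 2 + 110528

/-- The constant coefficient of `g₂` as a polynomial in `b`. -/
def constG₂ (c d : T) : T :=
  -5808 * c ^ 2 * d + 2106 * c * d ^ 3 - 319792 * c * d + 4968 * d ^ 3 - 714688 * d

/-- The coefficient of `b` in `g₃`. -/
def leadG₃ (d : T) : T := 243 * d ^ 6 - 8960 * d ^ 4 + 29952 * d ^ 2 - 26624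

/-- The constant coefficient of `g₃` as a polynomial in `b`. -/
def constG₃ (c d : T) : T :=
  5808 * c ^ 2 * d ^ 3 - 11648 * c ^ 2 * d - 2106 * c * d ^ 5 + 76432 * c * d ^ 3
    - 144768 * c * d - 4968 * d ^ 5 + 140608 * d ^ 3 - 259584 * d

theorem restG₁_mem {S : Subring T} {b c d : T} (hb : b ∈ S) (hc : c ∈ S) (hd : d ∈ S) :
    restG₁ b c d ∈ S := by
  unfold restG₁
  repeat' first | apply add_mem | apply sub_mem | apply mul_mem | apply pow_mem |
    apply neg_mem | apply ofNat_mem | assumption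

theorem leadG₂_mem {S : Subring T} {c d : T} (hc : c ∈ S) (hd : d ∈ S) : leadG₂ c d ∈ S := by
  unfold leadG₂
  repeat' first | apply add_mem | apply sub_mem | apply mul_mem | apply pow_mem |
    apply neg_mem | apply ofNat_mem | assumption

theorem constG₂_mem {S : Subring T} {c d : T} (hc : c ∈ S) (hd : d ∈ S) : constG₂ c d ∈ S := by
  unfold constG₂
  repeat' first | apply add_mem | apply sub_mem | apply mul_mem | apply pow_mem |
    apply neg_mem | apply ofNat_mem | assumption

theorem leadG₃_mem {S : Subring T} {d : T} (hd : d ∈ S) : leadG₃ d ∈ S := by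
  unfold leadG₃
  repeat' first | apply add_mem | apply sub_mem | apply mul_mem | apply pow_mem |
    apply neg_mem | apply ofNat_mem | assumption

theorem constG₃_mem {S : Subring T} {c d : T} (hc : c ∈ S) (hd : d ∈ S) : constG₃ c d ∈ S := by
  unfold constG₃
  repeat' first | apply add_mem | apply sub_mem | apply mul_mem | apply pow_mem |
    apply neg_mem | apply ofNat_mem | assumption

theorem map_leadG₂ {T' : Type*} [CommRing T'] (f : T →+* T') (c d : T) :
    f (leadG₂ c d) = leadG₂ (f c) (f d) := by
  simp [leadG₂, map_ofNat]

theorem map_constG₂ {T' : Type*} [CommRing T'] (f : T →+* T') (c d : T) :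
    f (constG₂ c d) = constG₂ (f c) (f d) := by
  simp [constG₂, map_ofNat]

theorem map_leadG₃ {T' : Type*} [CommRing T'] (f : T →+* T') (d : T) :
    f (leadG₃ d) = leadG₃ (f d) := by
  simp [leadG₃, map_ofNat]

theorem map_constG₃ {T' : Type*} [CommRing T'] (f : T →+* T') (c d : T) :
    f (constG₃ c d) = constG₃ (f c) (f d) := by
  simp [constG₃, map_ofNat]

namespace IsCurvePoint

variable {a b c d : T}

theorem of_ringHom {T' : Type*} [CommRing T'] (f : T →+* T')
    (h₁ : f (630272 * a - 11421 * b * d ^ 5 + 411400 * b * d ^ 3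
        - 871552 * b * d - 272976 * c ^ 2 * d ^ 2 + 315136 * c ^ 2
        + 98982 * c * d ^ 4 - 3508064 * c * d ^ 2 + 2205952 * c
        + 233496 * d ^ 4 - 6409856 * d ^ 2 + 4411904) = 0)
    (h₂ : f (78784 * b * c - 243 * b * d ^ 4 + 37040 * b * d ^ 2
        + 110528 * b - 5808 * c ^ 2 * d + 2106 * c * d ^ 3
        - 319792 * c * d + 4968 * d ^ 3 - 714688 * d) = 0)
    (h₃ : f (243 * b * d ^ 6 - 8960 * b * d ^ 4 + 29952 * b * d ^ 2
        - 26624 * b + 5808 * c ^ 2 * d ^ 3 - 11648 * c ^ 2 * d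
        - 2106 * c * d ^ 5 + 76432 * c * d ^ 3 - 144768 * c * d
        - 4968 * d ^ 5 + 140608 * d ^ 3 - 259584 * d) = 0)
    (h₄ : f (2 * c ^ 3 + 28 * c ^ 2 - 3 * c * d ^ 2 + 98 * c
        - 8 * d ^ 2 + 104) = 0) :
    IsCurvePoint (f a) (f b) (f c) (f d) := by
  constructor
  · simpa [map_ofNat] using h₁
  · simpa [map_ofNat] using h₂
  · simpa [map_ofNat] using h₃
  · simpa [map_ofNat] using h₄

theorem map {T' : Type*} [CommRing T'] (f : T →+* T') (h : IsCurvePoint a b c d) :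
    IsCurvePoint (f a) (f b) (f c) (f d) :=
  of_ringHom f (by rw [h.eq₁, map_zero]) (by rw [h.eq₂, map_zero]) (by rw [h.eq₃, map_zero])
    (by rw [h.eq₄, map_zero])

theorem mul_eq_neg_restG₁ (h : IsCurvePoint a b c d) : 630272 * a = -restG₁ b c d := by
  unfold restG₁
  linear_combination h.eq₁

theorem leadG₂_mul (h : IsCurvePoint a b c d) : leadG₂ c d * b = -constG₂ c d := by
  unfold leadG₂ constG₂
  linear_combination h.eq₂

theorem leadG₃_mul (h : IsCurvePoint a b c d) : leadG₃ d * b = -constG₃ c d := by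
  unfold leadG₃ constG₃
  linear_combination h.eq₃

theorem isCoprime [Algebra ℂ T] (h : IsCurvePoint a b c d) :
    IsCoprime (leadG₂ c d) (leadG₃ d) := by
  have hN : IsUnit (692701010891342264541184 : T) := by
    have : IsUnit (692701010891342264541184 : ℂ) := by norm_num
    simpa only [map_ofNat] using this.map (algebraMap ℂ T)
  obtain ⟨n, hn⟩ := hN.exists_left_inv
  refine ⟨n * (-34216716217749252928 + 205222648679853989444 * d ^ 2
      - 13758945986289671856 * c + 76958094379288956717 * c * d ^ 2
      - 1092233560255194448 * c ^ 2 + 7956141140025 * c ^ 2 * d ^ 2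
      - b * (171619072000277380756 * d + 93276118988159098696 * c * d
        + 5919861043476835380 * c ^ 2 * d)),
    n * (799172657029604 - 99185909903223 * c + 7956141140025 * c ^ 2), ?_⟩
  unfold leadG₂ leadG₃
  linear_combination hn - n * (171619072000277380756 * d + 93276118988159098696 * c * d
        + 5919861043476835380 * c ^ 2 * d) * h.eq₂
    + n * (-43025264405572619695616 - 976757766957480085459584 * d ^ 2
        + 6233613678781107655140 * d ^ 4 - 17191276470256729943520 * c * d ^ 2) * h.eq₄

/-- If `c` is algebraic over `k`, so are the other coordinates of the point. -/
theorem isAlgebraic {k : Type*} [CommRing k] [IsDomain k] [IsDomain T] [Algebra k T]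
    [Algebra ℂ T] (h : IsCurvePoint a b c d) (hc : IsAlgebraic k c) :
    IsAlgebraic k a ∧ IsAlgebraic k b ∧ IsAlgebraic k d := by
  have : CharZero T := Algebra.charZero_of_charZero ℂ T
  let S : Subring T := (Subalgebra.algebraicClosure k T).toSubring
  have key {y z : T} (hy : y ≠ 0) (hyS : y ∈ S) (hyz : y * z ∈ S) : z ∈ S :=
    IsAlgebraic.of_mul (mem_nonZeroDivisors_of_ne_zero hy) hyS hyz
  have hc : c ∈ S := hc
  have hd : d ∈ S := by
    refine IsAlgebraic.of_pow (n := 2) two_pos (key (y := 3 * c + 8) (fun h0 => ?_)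
      (add_mem (mul_mem (ofNat_mem S 3) hc) (ofNat_mem S 8)) ?_)
    · have : (104 : T) = 0 := by
        linear_combination 27 * h.eq₄ + (27 * d ^ 2 - 18 * c ^ 2 - 204 * c - 338) * h0
      norm_num at this
    · rw [show (3 * c + 8) * d ^ 2 = 2 * c ^ 3 + 28 * c ^ 2 + 98 * c + 104 by
        linear_combination -h.eq₄]
      repeat' first | apply add_mem | apply mul_mem | apply pow_mem | apply ofNat_mem | assumption
  have hb : b ∈ S := by
    by_cases h2 : leadG₂ c d = 0
    · have h3 : leadG₃ d ≠ 0 := fun h3 => by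
        simpa [h2, h3] using h.isCoprime.ne_zero_or_ne_zero
      exact key h3 (leadG₃_mem hd) (h.leadG₃_mul ▸ neg_mem (constG₃_mem hc hd))
    · exact key h2 (leadG₂_mem hc hd) (h.leadG₂_mul ▸ neg_mem (constG₂_mem hc hd))
  exact ⟨key (y := 630272) (by norm_num) (ofNat_mem S _)
    (h.mul_eq_neg_restG₁ ▸ neg_mem (restG₁_mem hb hc hd)), hb, hd⟩

theorem exists_of_leadG₂_ne_zero {K : Type*} [Field K] [CharZero K] {c d : K}
    (h0 : leadG₂ c d ≠ 0)
    (h4 : 2 * c ^ 3 + 28 * c ^ 2 - 3 * c * d ^ 2 + 98 * c - 8 * d ^ 2 + 104 = 0) :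
    ∃ a b : K, IsCurvePoint a b c d := by
  obtain ⟨b, hb⟩ : ∃ b, leadG₂ c d * b = -constG₂ c d :=
    ⟨-constG₂ c d / leadG₂ c d, mul_div_cancel₀ _ h0⟩
  obtain ⟨a, ha⟩ : ∃ a, 630272 * a = -restG₁ b c d := ⟨_, mul_div_cancel₀ _ (by norm_num)⟩
  refine ⟨a, b, ?_, ?_, mul_left_cancel₀ h0 ?_, h4⟩
  · unfold restG₁ at ha
    linear_combination ha
  · unfold leadG₂ constG₂ at hb
    linear_combination hb
  · unfold leadG₂ constG₂ at hb
    unfold leadG₂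
    linear_combination (243 * d ^ 6 - 8960 * d ^ 4 + 29952 * d ^ 2 - 26624) * hb +
      (-458838016 * d + 228788736 * d ^ 3) * h4

end IsCurvePoint

end CurvePoint

/-- The ideal `(g₁, g₂, g₃, g₄)`. -/
noncomputable abbrev curveIdeal : Ideal (MvPolynomial (Fin 4) ℂ) :=
  Ideal.span {curveG₁, curveG₂, curveG₃, curveG₄}

/-- The coordinate ring `ℂ[a,b,c,d] ⧸ (g₁, g₂, g₃, g₄)`. -/
abbrev CurveRing : Type := MvPolynomial (Fin 4) ℂ ⧸ curveIdeal

namespace CurveRing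

/-- The coordinate functions on the curve. -/
noncomputable def coord (j : Fin 4) : CurveRing := Ideal.Quotient.mk curveIdeal (X j)

theorem isCurvePoint_coord : IsCurvePoint (coord 0) (coord 1) (coord 2) (coord 3) := by
  have h {g : MvPolynomial (Fin 4) ℂ}
      (hg : g ∈ ({curveG₁, curveG₂, curveG₃, curveG₄} : Set (MvPolynomial (Fin 4) ℂ))) :
      Ideal.Quotient.mk curveIdeal g = 0 :=
    Ideal.Quotient.eq_zero_iff_mem.2 (Ideal.subset_span hg)
  exact .of_ringHom _ (h (g := curveG₁) (by simp)) (h (g := curveG₂) (by simp))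
    (h (g := curveG₃) (by simp)) (h (g := curveG₄) (by simp))

/-- A point of the curve with coordinates in `T` gives a homomorphism to `T`. -/
noncomputable def eval {T : Type*} [CommRing T] [Algebra ℂ T] {a b c d : T}
    (h : IsCurvePoint a b c d) : CurveRing →ₐ[ℂ] T :=
  Ideal.Quotient.liftₐ curveIdeal (aeval ![a, b, c, d]) fun p hp => by
    refine (Ideal.span_le (I := RingHom.ker (aeval ![a, b, c, d]))).2 ?_ hp
    rintro g (rfl | rfl | rfl | rfl)
    · simpa [curveG₁, RingHom.mem_ker] using h.eq₁
    · simpa [curveG₂, RingHom.mem_ker] using h.eq₂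
    · simpa [curveG₃, RingHom.mem_ker] using h.eq₃
    · simpa [curveG₄, RingHom.mem_ker] using h.eq₄

theorem eval_coord {T : Type*} [CommRing T] [Algebra ℂ T] {a b c d : T}
    (h : IsCurvePoint a b c d) (j : Fin 4) : eval h (coord j) = ![a, b, c, d] j :=
  aeval_X _ j

theorem mem_of_coord_mem {S : Subring CurveRing} (hC : ∀ z : ℂ, algebraMap ℂ CurveRing z ∈ S)
    (hX : ∀ j, coord j ∈ S) (x : CurveRing) : x ∈ S := by
  obtain ⟨p, rfl⟩ := Ideal.Quotient.mk_surjective x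
  induction p using MvPolynomial.induction_on with
  | C z => exact hC z
  | add p q hp hq => rw [map_add]; exact add_mem hp hq
  | mul_X p j hp => rw [map_mul]; exact mul_mem hp (hX j)

theorem isCurvePoint_of_sq {e : ℂ} (he : e ^ 2 = -8) :
    IsCurvePoint (-33 / 14) (13 / 28 * e) (-3) e := by
  have h3 : e ^ 3 = -8 * e := by rw [pow_succ, he]
  have h4 : e ^ 4 = 64 := by rw [show e ^ 4 = (e ^ 2) ^ 2 by ring, he]; norm_num
  have h5 : e ^ 5 = 64 * e := by rw [pow_succ, h4]
  have h6 : e ^ 6 = -512 := by rw [show e ^ 6 = (e ^ 2) ^ 3 by ring, he]; norm_num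
  have h7 : e ^ 7 = -512 * e := by rw [pow_succ, h6]
  constructor
  · linear_combination (-11421 * 13 / 28) * h6 + (411400 * 13 / 28 - 98982 * 3 + 233496) * h4 +
      (-871552 * 13 / 28 - 272976 * 9 + 3508064 * 3 - 6409856) * he
  · linear_combination (-243 * 13 / 28) * h5 + (37040 * 13 / 28 - 2106 * 3 + 4968) * h3
  · linear_combination (243 * 13 / 28) * h7 + (-8960 * 13 / 28 + 2106 * 3 - 4968) * h5 +
      (29952 * 13 / 28 + 5808 * 9 - 76432 * 3 + 140608) * h3
  · linear_combination he

theorem leadG₂_of_sq {e : ℂ} (he : e ^ 2 = -8) : leadG₂ (-3) e ≠ 0 := by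
  have : leadG₂ (-3) e = -437696 := by
    unfold leadG₂
    linear_combination (-243 * e ^ 2 + 38984) * he
  rw [this]
  norm_num

theorem not_isField : ¬ IsField CurveRing := by
  intro hF
  let : Field CurveRing := hF.toField
  obtain ⟨e, he⟩ := IsAlgClosed.exists_pow_nat_eq (-8 : ℂ) two_pos
  have he' : (-e) ^ 2 = -8 := by rw [neg_sq, he]
  have h1 : coord 3 = algebraMap ℂ CurveRing e :=
    (eval (isCurvePoint_of_sq he)).toRingHom.injective (by
      simpa using eval_coord (isCurvePoint_of_sq he) 3)
  have h2 := eval_coord (isCurvePoint_of_sq he') 3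
  rw [h1, AlgHom.commutes] at h2
  have h3 : e = -e := by simpa using h2
  obtain rfl : e = 0 := self_eq_neg.1 h3
  norm_num at he

end CurveRing

open Polynomial (planeCurve irreducible_planeCurve)

/-- The elements `x` of `A` with `φ t ^ n * x` in the image of `φ` for some `n`. -/
def denominatorSubring {B A : Type*} [CommRing B] [CommRing A] (φ : B →+* A) (t : B) :
    Subring A where
  carrier := {x | ∃ n : ℕ, ∃ y, φ t ^ n * x = φ y}
  mul_mem' := by
    rintro x x' ⟨n, y, h⟩ ⟨n', y', h'⟩
    exact ⟨n + n', y * y', by rw [map_mul, ← h, ← h']; ring⟩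
  one_mem' := ⟨0, 1, by simp⟩
  add_mem' := by
    rintro x x' ⟨n, y, h⟩ ⟨n', y', h'⟩
    refine ⟨n + n', t ^ n' * y + t ^ n * y', ?_⟩
    rw [map_add, map_mul, map_mul, ← h, ← h', map_pow, map_pow]
    ring
  zero_mem' := ⟨0, 0, by simp⟩
  neg_mem' := by
    rintro x ⟨n, y, h⟩
    exact ⟨n, -y, by rw [map_neg, ← h]; ring⟩

theorem map_mem_denominatorSubring {B A : Type*} [CommRing B] [CommRing A] (φ : B →+* A) (t y : B) :
    φ y ∈ denominatorSubring φ t :=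
  ⟨0, y, by simp⟩

/-- If every element of `A` becomes an element of `B` after multiplication by a power of `t`, a
homomorphism out of `A` which is injective on `B` kills only `t`-power torsion. -/
theorem exists_pow_mul_eq_zero {B A K : Type*} [CommRing B] [CommRing A] [CommRing K]
    {φ : B →+* A} {ψ : A →+* K} (hinj : Function.Injective (ψ.comp φ)) {t : B} {x : A}
    (hx : x ∈ denominatorSubring φ t) (h0 : ψ x = 0) : ∃ n : ℕ, φ t ^ n * x = 0 := by
  obtain ⟨n, y, h⟩ := hx
  refine ⟨n, ?_⟩
  have : y = 0 := hinj (by rw [map_zero, RingHom.comp_apply, ← h, map_mul, h0, mul_zero])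
  rw [h, this, map_zero]

/-- The coordinate ring of the plane curve `g₄ = 0`. -/
abbrev PlaneRing : Type := AdjoinRoot planeCurve

namespace PlaneRing

instance : IsDomain PlaneRing := AdjoinRoot.isDomain_of_prime irreducible_planeCurve.prime

/-- The coordinate function `c`. -/
noncomputable def c : PlaneRing := AdjoinRoot.of planeCurve Polynomial.X

/-- The coordinate function `d`. -/
noncomputable def d : PlaneRing := AdjoinRoot.root planeCurve

theorem eq_zero : 2 * c ^ 3 + 28 * c ^ 2 - 3 * c * d ^ 2 + 98 * c - 8 * d ^ 2 + 104 = 0 := by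
  have h := AdjoinRoot.eval₂_root planeCurve
  rw [Polynomial.eval₂_planeCurve] at h
  unfold c d
  linear_combination -h

/-- The map induced by the projection `(a, b, c, d) ↦ (c, d)`. -/
noncomputable def toCurveRing : PlaneRing →+* CurveRing :=
  AdjoinRoot.lift (Polynomial.aeval (CurveRing.coord 2)).toRingHom (CurveRing.coord 3) (by
    rw [Polynomial.eval₂_planeCurve, AlgHom.toRingHom_eq_coe, RingHom.coe_coe, Polynomial.aeval_X]
    linear_combination -CurveRing.isCurvePoint_coord.eq₄)

@[simp]
theorem toCurveRing_c : toCurveRing c = CurveRing.coord 2 := by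
  simp [toCurveRing, c]

@[simp]
theorem toCurveRing_d : toCurveRing d = CurveRing.coord 3 := by
  simp [toCurveRing, d]

theorem toCurveRing_algebraMap (z : ℂ) :
    toCurveRing (algebraMap ℂ PlaneRing z) = algebraMap ℂ CurveRing z := by
  rw [IsScalarTower.algebraMap_apply ℂ (Polynomial ℂ) PlaneRing, AdjoinRoot.algebraMap_eq,
    toCurveRing, AdjoinRoot.lift_of]
  exact (Polynomial.aeval (CurveRing.coord 2)).commutes z

theorem leadG₂_ne_zero : leadG₂ c d ≠ 0 := by
  intro h
  obtain ⟨e, he⟩ := IsAlgClosed.exists_pow_nat_eq (-8 : ℂ) two_pos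
  have hp := CurveRing.isCurvePoint_of_sq he
  apply CurveRing.leadG₂_of_sq he
  have := congrArg ((CurveRing.eval hp).toRingHom.comp toCurveRing) h
  rw [map_leadG₂, map_zero] at this
  simp only [AlgHom.toRingHom_eq_coe, RingHom.comp_apply, toCurveRing_c, toCurveRing_d,
    RingHom.coe_coe, CurveRing.eval_coord] at this
  exact this

end PlaneRing

namespace CurveRing

open PlaneRing (toCurveRing)

theorem mem_denominatorSubring {t : PlaneRing}
    (ht : toCurveRing t * coord 1 ∈ toCurveRing.range) (x : CurveRing) :
    x ∈ denominatorSubring toCurveRing t := by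
  set S := denominatorSubring toCurveRing t
  have hC (z : ℂ) : algebraMap ℂ CurveRing z ∈ S := by
    rw [← PlaneRing.toCurveRing_algebraMap]
    exact map_mem_denominatorSubring _ _ _
  have hb : coord 1 ∈ S := by
    obtain ⟨y, hy⟩ := ht
    exact ⟨1, y, by rw [pow_one, hy]⟩
  have hc : coord 2 ∈ S := PlaneRing.toCurveRing_c ▸ map_mem_denominatorSubring _ _ _
  have hd : coord 3 ∈ S := PlaneRing.toCurveRing_d ▸ map_mem_denominatorSubring _ _ _
  have ha : coord 0 ∈ S := by
    have hN : algebraMap ℂ CurveRing (1 / 630272) * 630272 = 1 := by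
      rw [← map_ofNat (algebraMap ℂ CurveRing), ← map_mul, ← map_one (algebraMap ℂ CurveRing)]
      norm_num
    rw [← one_mul (coord 0), ← hN, mul_assoc, isCurvePoint_coord.mul_eq_neg_restG₁]
    exact mul_mem (hC _) (neg_mem (restG₁_mem hb hc hd))
  refine mem_of_coord_mem hC (fun j => ?_) x
  fin_cases j
  exacts [ha, hb, hc, hd]

/-- The rational functions on the plane curve. -/
abbrev FunctionField : Type := FractionRing PlaneRing

theorem isCurvePoint_functionField : ∃ a b : FunctionField,
    IsCurvePoint a b (algebraMap PlaneRing FunctionField PlaneRing.c)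
      (algebraMap PlaneRing FunctionField PlaneRing.d) := by
  have : CharZero FunctionField := Algebra.charZero_of_charZero ℂ _
  refine IsCurvePoint.exists_of_leadG₂_ne_zero ?_ ?_
  · rw [← map_leadG₂]
    exact (map_ne_zero_iff _ (IsFractionRing.injective PlaneRing FunctionField)).2
      PlaneRing.leadG₂_ne_zero
  · have h4 := congrArg (algebraMap PlaneRing FunctionField) PlaneRing.eq_zero
    simpa only [map_add, map_sub, map_mul, map_pow, map_ofNat, map_zero] using h4

theorem exists_injective : ∃ ψ : CurveRing →+* FunctionField, Function.Injective ψ := by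
  obtain ⟨a, b, h⟩ := isCurvePoint_functionField
  refine ⟨(eval h).toRingHom, (injective_iff_map_eq_zero _).2 fun x hx => ?_⟩
  have hinj : Function.Injective ((eval h).toRingHom.comp toCurveRing) := by
    rw [show (eval h).toRingHom.comp toCurveRing = algebraMap PlaneRing FunctionField from ?_]
    · exact IsFractionRing.injective PlaneRing FunctionField
    · refine AdjoinRoot.ringHom_ext (Polynomial.ringHom_ext (fun z => ?_) ?_) ?_
      · have : AdjoinRoot.of planeCurve (Polynomial.C z) = algebraMap ℂ PlaneRing z := rfl
        simp only [RingHom.comp_apply, this, PlaneRing.toCurveRing_algebraMap]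
        exact ((eval h).commutes z).trans (IsScalarTower.algebraMap_apply ℂ PlaneRing _ z)
      · change eval h (toCurveRing PlaneRing.c) = _
        rw [PlaneRing.toCurveRing_c, eval_coord]
        rfl
      · change eval h (toCurveRing PlaneRing.d) = _
        rw [PlaneRing.toCurveRing_d, eval_coord]
        rfl
  obtain ⟨m, hm⟩ := exists_pow_mul_eq_zero hinj (mem_denominatorSubring
    (t := leadG₂ PlaneRing.c PlaneRing.d) ⟨-constG₂ PlaneRing.c PlaneRing.d, by
      rw [map_neg, map_constG₂, map_leadG₂, PlaneRing.toCurveRing_c, PlaneRing.toCurveRing_d,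
        isCurvePoint_coord.leadG₂_mul]⟩ x) hx
  obtain ⟨n, hn⟩ := exists_pow_mul_eq_zero hinj (mem_denominatorSubring
    (t := leadG₃ PlaneRing.d) ⟨-constG₃ PlaneRing.c PlaneRing.d, by
      rw [map_neg, map_constG₃, map_leadG₃, PlaneRing.toCurveRing_c, PlaneRing.toCurveRing_d,
        isCurvePoint_coord.leadG₃_mul]⟩ x) hx
  obtain ⟨u, v, huv⟩ := (isCurvePoint_coord.isCoprime.pow (m := m) (n := n))
  rw [map_leadG₂, PlaneRing.toCurveRing_c, PlaneRing.toCurveRing_d] at hm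
  rw [map_leadG₃, PlaneRing.toCurveRing_d] at hn
  linear_combination -x * huv + u * hm + v * hn

instance : IsDomain CurveRing := by
  obtain ⟨ψ, hψ⟩ := exists_injective
  exact hψ.isDomain ψ

/-- The coordinate ring as an algebra over `ℂ[c]`. -/
noncomputable abbrev algebraPolynomial : Algebra (Polynomial ℂ) CurveRing :=
  (Polynomial.aeval (coord 2)).toRingHom.toAlgebra

theorem isMaximal_of_isPrime {P : Ideal CurveRing} (hP0 : P ≠ ⊥) (hP : P.IsPrime) :
    P.IsMaximal := by
  obtain ⟨x, hxP, hx0⟩ := Submodule.exists_mem_ne_zero_of_ne_bot hP0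
  obtain ⟨q, hq0, hq⟩ : ∃ q : Polynomial ℂ, q ≠ 0 ∧ Polynomial.aeval (coord 2) q ∈ P := by
    let := algebraPolynomial
    have hc : IsAlgebraic (Polynomial ℂ) (coord 2) := by
      have : algebraMap (Polynomial ℂ) CurveRing Polynomial.X = coord 2 := Polynomial.aeval_X _
      exact this ▸ isAlgebraic_algebraMap _
    obtain ⟨ha, hb, hd⟩ := isCurvePoint_coord.isAlgebraic hc
    have hx : x ∈ (Subalgebra.algebraicClosure (Polynomial ℂ) CurveRing).toSubring := by
      refine mem_of_coord_mem (fun z => ?_) (fun j => ?_) x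
      · have : algebraMap (Polynomial ℂ) CurveRing (Polynomial.C z) = algebraMap ℂ CurveRing z :=
          Polynomial.aeval_C _ z
        exact this ▸ isAlgebraic_algebraMap _
      · fin_cases j
        exacts [ha, hb, hc, hd]
    obtain ⟨q, hq, hq0⟩ := Submodule.exists_mem_ne_zero_of_ne_bot
      (Ideal.comap_ne_bot_of_algebraic_mem hx0 hxP hx)
    exact ⟨q, hq0, hq⟩
  have hpt : IsCurvePoint (Ideal.Quotient.mk P (coord 0)) (Ideal.Quotient.mk P (coord 1))
      (Ideal.Quotient.mk P (coord 2)) (Ideal.Quotient.mk P (coord 3)) :=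
    isCurvePoint_coord.map _
  have hc : IsAlgebraic ℂ (Ideal.Quotient.mk P (coord 2)) := by
    refine ⟨q, hq0, ?_⟩
    rw [← Ideal.Quotient.mkₐ_eq_mk ℂ, Polynomial.aeval_algHom_apply]
    exact Ideal.Quotient.eq_zero_iff_mem.2 hq
  obtain ⟨ha, hb, hd⟩ := hpt.isAlgebraic hc
  have : Algebra.IsAlgebraic ℂ (CurveRing ⧸ P) := by
    refine ⟨fun y => ?_⟩
    obtain ⟨y, rfl⟩ := Ideal.Quotient.mk_surjective y
    refine mem_of_coord_mem (S := (Subalgebra.algebraicClosure ℂ (CurveRing ⧸ P)).toSubring.comap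
      (Ideal.Quotient.mk P)) (fun z => ?_) (fun j => ?_) y
    · exact isAlgebraic_algebraMap (A := CurveRing ⧸ P) z
    · fin_cases j
      exacts [ha, hb, hc, hd]
  exact Ideal.Quotient.maximal_of_isField _
    (isField_of_isIntegral_of_isField' (R := ℂ) (S := CurveRing ⧸ P) (Field.toIsField ℂ))

theorem ringKrullDim_eq_one : ringKrullDim CurveRing = 1 := by
  apply eq_of_le_of_not_lt ?_ fun h => not_isField ?_
  · rw [← Nat.cast_one, ← Ring.krullDimLE_iff]
    exact Ring.KrullDimLE.mk₁' fun P hP0 hP => isMaximal_of_isPrime hP0 hP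
  · have h' : ringKrullDim CurveRing ≤ 0 := Order.le_of_lt_succ h
    rw [← Nat.cast_zero, ← Ring.krullDimLE_iff] at h'
    exact Ring.KrullDimLE.isField_of_isDomain

end CurveRing

/-- The ideal `I = (g₁, g₂, g₃, g₄) ⊆ ℂ[a,b,c,d]` is prime and
the quotient ring `ℂ[a,b,c,d]/I` has Krull dimension `1`; i.e. the common
zero locus of `g₁, g₂, g₃, g₄` in `𝔸⁴_ℂ` is an irreducible affine curve. -/
theorem rm_curve_prime_dimension_one :
    (Ideal.span {curveG₁, curveG₂, curveG₃, curveG₄}).IsPrime ∧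
      ringKrullDim
        (MvPolynomial (Fin 4) ℂ ⧸
          Ideal.span {curveG₁, curveG₂, curveG₃, curveG₄}) = 1 := by
  exact ⟨(Ideal.Quotient.isDomain_iff_prime _).1 (inferInstanceAs (IsDomain CurveRing)),
    CurveRing.ringKrullDim_eq_one⟩
end

section
/- Let g₁, g₂, g₃, g₄ ∈ ℂ[a,b,c,d] be the polynomials g₁ = 630272·a − 11421·b·d⁵ + 411400·b·d³ − 871552·b·d − 272976·c²·d² + 315136·c² + 98982·c·d⁴ − 3508064·c·d² + 2205952·c + 233496·d⁴ − 6409856·d² + 4411904, g₂ = 78784·b·c − 243·b·d⁴ + 37040·b·d² + 110528·b − 5808·c²·d + 2106·c·d³ − 319792·c·d + 4968·d³ − 714688·d, g₃ = 243·b·d⁶ − 8960·b·d⁴ + 29952·b·d² − 26624·b + 5808·c²·d³ − 11648·c²·d − 2106·c·d⁵ + 76432·c·d³ − 144768·c·d − 4968·d⁵ + 140608·d³ − 259584·d, and g₄ = 2·c³ + 28·c² − 3·c·d² + 98·c − 8·d² + 104. Then at every point p ∈ ℂ⁴ with g₁(p) = g₂(p) = g₃(p) = g₄(p) = 0, the 4×4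 Jacobian matrix (∂gᵢ/∂xⱼ(p))_{1≤i,j≤4}, where (x₁,x₂,x₃,x₄) = (a,b,c,d), has rank exactly 3. (Thus the affine curve defined by g₁ = g₂ = g₃ = g₄ = 0 in 𝔸⁴_ℂ is nonsingular.) -/
open MvPolynomial

/-- The system `(g₁, g₂, g₃, g₄)` as a function `Fin 4 → ℂ[a,b,c,d]`. -/
noncomputable def curveG : Fin 4 → MvPolynomial (Fin 4) ℂ :=
  ![curveG₁, curveG₂, curveG₃, curveG₄]

/-- The coefficient of `b` in `g₂`. -/
noncomputable def coeffG₂ : MvPolynomial (Fin 4) ℂ :=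
  78784 * X 2 - 243 * X 3 ^ 4 + 37040 * X 3 ^ 2 + 110528

/-- The coefficient of `b` in `g₃`. -/
noncomputable def coeffG₃ : MvPolynomial (Fin 4) ℂ :=
  243 * X 3 ^ 6 - 8960 * X 3 ^ 4 + 29952 * X 3 ^ 2 - 26624

/-- The quotient of the resultant of `g₂` and `g₃` in `b` by `g₄`. -/
noncomputable def resultantQuotient : MvPolynomial (Fin 4) ℂ :=
  X 3 * (228788736 * X 3 ^ 2 - 458838016)

theorem coeffG_resultant :
    coeffG₂ * curveG₃ - coeffG₃ * curveG₂ = resultantQuotient * curveG₄ := by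
  simp only [coeffG₂, coeffG₃, curveG₂, curveG₃, curveG₄, resultantQuotient]
  ring

theorem no_common_zero_of_coeffs (c t : ℂ)
    (h4 : t * (3 * c + 8) = 2 * c ^ 3 + 28 * c ^ 2 + 98 * c + 104)
    (h2 : 78784 * c - 243 * t ^ 2 + 37040 * t + 110528 = 0)
    (h3 : 243 * t ^ 3 - 8960 * t ^ 2 + 29952 * t - 26624 = 0)
    (hN : -5808 * c ^ 2 + 2106 * c * t - 319792 * c + 4968 * t - 714688 = 0) : False := by
  have hsq : t ^ 2 * (3 * c + 8) ^ 2 = (2 * c ^ 3 + 28 * c ^ 2 + 98 * c + 104) ^ 2 := by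
    rw [← h4]; ring
  have hcu : t ^ 3 * (3 * c + 8) ^ 3 = (2 * c ^ 3 + 28 * c ^ 2 + 98 * c + 104) ^ 3 := by
    rw [← h4]; ring
  have r2 : 35262784 + 45990048 * c + 20214100 * c ^ 2 + 2978384 * c ^ 3 - 63528 * c ^ 4
      - 27216 * c ^ 5 - 972 * c ^ 6 = 0 := by
    linear_combination (3 * c + 8) ^ 2 * h2 + 243 * hsq - 37040 * (3 * c + 8) * h4
  have r3 : -316219904 - 657098624 * c - 488035424 * c ^ 2 - 107557608 * c ^ 3
      + 52624560 * c ^ 4 + 39404648 * c ^ 5 + 10341824 * c ^ 6 + 1321320 * c ^ 7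
      + 81648 * c ^ 8 + 1944 * c ^ 9 = 0 := by
    linear_combination (3 * c + 8) ^ 3 * h3 - 243 * hcu + 8960 * (3 * c + 8) * hsq
      - 29952 * (3 * c + 8) ^ 2 * h4
  have rN : -5200832 - 3996512 * c - 660348 * c ^ 2 + 51480 * c ^ 3 + 4212 * c ^ 4 = 0 := by
    linear_combination (3 * c + 8) * hN - (2106 * c + 4968) * h4
  have k : 617 / 9 + 595 / 9 * c + 163 / 9 * c ^ 2 + c ^ 3 = 0 := by
    linear_combination
      (381499147 / 223449071616 + 561736445 / 446898143232 * c
        - 146397311 / 1191728381952 * c ^ 2 - 850348583 / 3575185145856 * c ^ 3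
        - 145019807 / 3575185145856 * c ^ 4 - 758965 / 397242793984 * c ^ 5) * r2
      + (339950855 / 1787592572928 - 49390217 / 7150370291712 * c
        - 758965 / 794485587968 * c ^ 2) * r3
  refine one_ne_zero (α := ℂ) ?_
  linear_combination
    (3377526833061 / 94337643358 + 15837729322419 / 1320727007012 * c
      - 7001288607015 / 10565816056096 * c ^ 2 - 705477675573 / 10565816056096 * c ^ 3) * k
    + (259186887795 / 549422434916992 + 17215691747 / 68677804364624 * c
      + 8709600933 / 549422434916992 * c ^ 2) * rN

theorem eval_coeffG_ne_zero {p : Fin 4 → ℂ} (h2 : eval p curveG₂ = 0) (h4 : eval p curveG₄ = 0) :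
    eval p coeffG₂ ≠ 0 ∨ eval p coeffG₃ ≠ 0 := by
  by_contra! h
  obtain ⟨hb2, hb3⟩ := h
  simp only [curveG₂, curveG₄, coeffG₂, coeffG₃, map_add, map_sub, map_mul, map_pow, eval_X,
    map_ofNat] at h2 h4 hb2 hb3
  have hN : p 3 * (-5808 * p 2 ^ 2 + 2106 * p 2 * p 3 ^ 2 - 319792 * p 2 + 4968 * p 3 ^ 2
      - 714688) = 0 := by
    linear_combination h2 - p 1 * hb2
  rcases mul_eq_zero.mp hN with hd | hN
  · simp [hd] at hb3
  · exact no_common_zero_of_coeffs (p 2) (p 3 ^ 2) (by linear_combination -h4)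
      (by linear_combination hb2) (by linear_combination hb3) hN

theorem pderiv_ofNat (j : Fin 4) (n : ℕ) [n.AtLeastTwo] :
    pderiv j (ofNat(n) : MvPolynomial (Fin 4) ℂ) = 0 := by
  rw [← map_ofNat (C (R := ℂ) (σ := Fin 4)) n, pderiv_C]

theorem pderiv_curveG₄_ne_zero {p : Fin 4 → ℂ} (h4 : eval p curveG₄ = 0) :
    eval p (pderiv 2 curveG₄) ≠ 0 ∨ eval p (pderiv 3 curveG₄) ≠ 0 := by
  by_contra! h
  obtain ⟨hc, hd⟩ := h
  simp [curveG₄, pderiv_X, pderiv_ofNat] at h4 hc hd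
  have hd' : p 3 * (3 * p 2 + 8) = 0 := by linear_combination -hd / 2
  refine one_ne_zero (α := ℂ) ?_
  rcases mul_eq_zero.mp hd' with hd | hc8
  · linear_combination (1045 / 1664 + 147 / 1664 * p 2) * h4
      + (-21 / 32 - 577 / 1664 * p 2 - 49 / 1664 * p 2 ^ 2) * hc
      + p 3 * ((1045 / 1664 + 147 / 1664 * p 2) * (3 * p 2 + 8)
        + 3 * (-21 / 32 - 577 / 1664 * p 2 - 49 / 1664 * p 2 ^ 2)) * hd
  · linear_combination 27 / 104 * h4
      - 27 / 104 * (2 / 3 * p 2 ^ 2 + 68 / 9 * p 2 + 338 / 27 - p 3 ^ 2) * hc8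

theorem rank_lt_of_vecMul_eq_zero {K : Type*} [Field K] {n : ℕ} {M : Matrix (Fin n) (Fin n) K}
    {v : Fin n → K} (hv : v ≠ 0) (h : Matrix.vecMul v M = 0) : M.rank < n := by
  refine lt_of_le_of_ne (by simpa using M.rank_le_card_width) fun hr => ?_
  have hM : LinearIndependent K M.row := by
    rw [linearIndependent_iff_card_eq_finrank_span, Set.finrank,
      ← Matrix.rank_eq_finrank_span_row, hr, Fintype.card_fin]
  exact hv (Matrix.vecMul_injective_iff.mpr hM (by simpa using h))

/-- At every common zero `p ∈ ℂ⁴` of `g₁, g₂, g₃, g₄`, the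
Jacobian matrix `(∂gᵢ/∂xⱼ(p))` has rank exactly `3`; thus the affine curve
`g₁ = g₂ = g₃ = g₄ = 0` in `𝔸⁴_ℂ` is nonsingular. -/
theorem rm_curve_nonsingular
    (p : Fin 4 → ℂ) (hp : ∀ i : Fin 4, eval p (curveG i) = 0) :
    (Matrix.of fun i j : Fin 4 => eval p (pderiv j (curveG i))).rank = 3 := by
  have h2 : eval p curveG₂ = 0 := hp 1
  have h3 : eval p curveG₃ = 0 := hp 2
  have h4 : eval p curveG₄ = 0 := hp 3
  set M := Matrix.of fun i j : Fin 4 => eval p (pderiv j (curveG i)) with hM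
  have hB := eval_coeffG_ne_zero h2 h4
  have hrel (j : Fin 4) : eval p coeffG₂ * M 2 j - eval p coeffG₃ * M 1 j
      - eval p resultantQuotient * M 3 j = 0 := by
    have := congrArg (fun q => eval p (pderiv j q)) coeffG_resultant
    simp only [map_sub, Derivation.leibniz, smul_eq_mul, map_add, map_mul, h2, h3, h4] at this
    simp only [hM, Matrix.of_apply, curveG, Matrix.cons_val]
    linear_combination this
  have hlt : M.rank < 4 := by
    refine rank_lt_of_vecMul_eq_zero
      (v := ![0, -eval p coeffG₃, eval p coeffG₂, -eval p resultantQuotient]) ?_ ?_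
    · intro hv
      rcases hB with hB | hB
      · exact hB (by simpa using congrFun hv 2)
      · exact hB (by simpa using congrFun hv 1)
    · ext j
      simp only [Matrix.vecMul, dotProduct, Fin.sum_univ_four, Matrix.cons_val, Pi.zero_apply]
      linear_combination hrel j
  have m00 : M 0 0 = 630272 := by
    simp [hM, curveG, curveG₁, pderiv_X, pderiv_ofNat]
  have m10 : M 1 0 = 0 := by
    simp [hM, curveG, curveG₂, pderiv_X, pderiv_ofNat]
  have m20 : M 2 0 = 0 := by
    simp [hM, curveG, curveG₃, pderiv_X, pderiv_ofNat]
  have m30 : M 3 0 = 0 := by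
    simp [hM, curveG, curveG₄, pderiv_X, pderiv_ofNat]
  have m31 : M 3 1 = 0 := by
    simp [hM, curveG, curveG₄, pderiv_X, pderiv_ofNat]
  have m11 : M 1 1 = eval p coeffG₂ := by
    simp [hM, curveG, curveG₂, coeffG₂, pderiv_X, pderiv_ofNat]
    ring
  have m21 : M 2 1 = eval p coeffG₃ := by
    simp [hM, curveG, curveG₃, coeffG₃, pderiv_X, pderiv_ofNat]
    ring
  have hle {i j : Fin 4} (hi0 : M i 0 = 0) (hi1 : M i 1 ≠ 0) (hj : M 3 j ≠ 0) : 3 ≤ M.rank := by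
    have hdet : (M.submatrix ![0, i, 3] ![0, 1, j]).det ≠ 0 := by
      rw [Matrix.det_fin_three]
      simp only [Matrix.submatrix_apply, Matrix.cons_val]
      simp [m00, m30, m31, hi0, hi1, hj]
    calc 3 = (M.submatrix ![0, i, 3] ![0, 1, j]).rank := by
          rw [Matrix.rank_of_det_ne_zero hdet, Fintype.card_fin]
      _ ≤ M.rank := M.rank_submatrix_le _ _
  have hge : 3 ≤ M.rank := by
    rcases hB with hB | hB <;> rcases pderiv_curveG₄_ne_zero h4 with hD | hD
    · exact hle m10 (m11 ▸ hB) hD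
    · exact hle m10 (m11 ▸ hB) hD
    · exact hle m20 (m21 ▸ hB) hD
    · exact hle m20 (m21 ▸ hB) hD
  omega
end
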